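/- Let r ≥ 2 and t ≥ 4. In R = K[x_0,...,x_r], let J be the monomial ideal ⟨x_1,...,x_{r-1}⟩⁴ + x_0·⟨x_2,...,x_{r-1}⟩³ + x_r·⟨x_2,...,x_{r-2}⟩³. Then the dimension over K of the degree-t homogeneous component of J equals C(r+t, r) − (r² t + 2 − r²). -/

import Mathlib

open MvPolynomial

/-- The variable `x_i` in `K[x_0, ..., x_r]`, or `0` if `i > r`. -/
noncomputable def xv {K : Type*} [Field K] {r : ℕ} (i : ℕ) : MvPolynomial (Fin (r + 1)) K :=
  if h : i ≤ r then X ⟨i, Nat.lt_succ_of_le h⟩ else 0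

/-- The ideal generated by the variables `x_a, ..., x_b`. -/
noncomputable def varIdeal (K : Type*) [Field K] (r a b : ℕ) :
    Ideal (MvPolynomial (Fin (r + 1)) K) :=
  Ideal.span {p | ∃ i : ℕ, a ≤ i ∧ i ≤ b ∧ p = xv i}

/-- The ideal generated by the monomials with exponents in `S`. -/
noncomputable def monomialSpan {σ : Type*} (K : Type*) [CommSemiring K] (S : Set (σ →₀ ℕ)) :
    Ideal (MvPolynomial σ K) :=
  Ideal.span ((fun s => monomial s (1 : K)) '' S)

section MonomialSpan

variable {σ K : Type*} [CommSemiring K]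

theorem monomialSpan_sup (S T : Set (σ →₀ ℕ)) :
    monomialSpan K S ⊔ monomialSpan K T = monomialSpan K (S ∪ T) := by
  simp only [monomialSpan, Set.image_union, Ideal.span_union]

open scoped Pointwise in
theorem monomialSpan_mul (S T : Set (σ →₀ ℕ)) :
    monomialSpan K S * monomialSpan K T = monomialSpan K (S + T) := by
  rw [monomialSpan, monomialSpan, Ideal.span_mul_span', monomialSpan]
  congr 1
  rw [← Set.image2_mul, ← Set.image2_add, Set.image2_image_left, Set.image2_image_right,
    Set.image_image2]
  simp

theorem span_X_eq_monomialSpan (M : Set σ) :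
    Ideal.span (X '' M : Set (MvPolynomial σ K)) =
      monomialSpan K ((fun i => Finsupp.single i 1) '' M) := by
  rw [monomialSpan, Set.image_image]
  rfl

open scoped Pointwise in
theorem setOf_le_sum_add_single (M : Finset σ) (n : ℕ) :
    {m : σ →₀ ℕ | n ≤ ∑ i ∈ M, m i} + (fun i => Finsupp.single i 1) '' (M : Set σ) =
      {m : σ →₀ ℕ | n + 1 ≤ ∑ i ∈ M, m i} := by
  classical
  ext m
  simp only [Set.mem_add, Set.mem_ofPred_eq, Set.mem_image, Finset.mem_coe]
  constructor
  · rintro ⟨a, ha, _, ⟨i, hi, rfl⟩, rfl⟩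
    simp only [Finsupp.add_apply, Finset.sum_add_distrib, Finsupp.single_apply,
      Finset.sum_ite_eq, hi, if_true]
    omega
  · intro h
    obtain ⟨i, hi, hmi⟩ : ∃ i ∈ M, m i ≠ 0 :=
      Finset.exists_ne_zero_of_sum_ne_zero (by omega)
    have hm : m - Finsupp.single i 1 + Finsupp.single i 1 = m :=
      tsub_add_cancel_of_le (by simpa [Nat.one_le_iff_ne_zero] using hmi)
    refine ⟨m - Finsupp.single i 1, ?_, _, ⟨i, hi, rfl⟩, hm⟩
    rw [← hm] at h
    simp only [Finsupp.add_apply, Finset.sum_add_distrib (f := fun j => (m - _) j),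
      Finsupp.single_apply, Finset.sum_ite_eq, hi, if_true] at h
    omega

theorem span_X_pow (M : Finset σ) (n : ℕ) :
    Ideal.span (X '' (M : Set σ) : Set (MvPolynomial σ K)) ^ n =
      monomialSpan K {m | n ≤ ∑ i ∈ M, m i} := by
  induction n with
  | zero =>
    rw [pow_zero, Ideal.one_eq_top, eq_comm, Ideal.eq_top_iff_one]
    exact Ideal.subset_span ⟨0, by simp, rfl⟩
  | succ n ih =>
    rw [pow_succ, ih, span_X_eq_monomialSpan, monomialSpan_mul, setOf_le_sum_add_single]

open scoped Pointwise in
theorem span_X_singleton_mul_pow (j : σ) (M : Finset σ) (n : ℕ) :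
    Ideal.span {X j} * Ideal.span (X '' (M : Set σ) : Set (MvPolynomial σ K)) ^ n =
      monomialSpan K ({Finsupp.single j 1} + {m | n ≤ ∑ i ∈ M, m i}) := by
  rw [span_X_pow, ← monomialSpan_mul, ← Set.image_singleton (f := X), span_X_eq_monomialSpan,
    Set.image_singleton]

theorem mem_monomialSpan {S : Set (σ →₀ ℕ)} {p : MvPolynomial σ K} :
    p ∈ monomialSpan K S ↔ ∀ m ∈ p.support, ∃ s ∈ S, s ≤ m :=
  mem_ideal_span_monomial_image

open scoped Pointwise in
theorem exists_single_add_le_iff {j : σ} {M : Finset σ} (hj : j ∉ M) (n : ℕ) (m : σ →₀ ℕ) :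
    (∃ s ∈ {Finsupp.single j 1} + {m : σ →₀ ℕ | n ≤ ∑ i ∈ M, m i}, s ≤ m) ↔
      1 ≤ m j ∧ n ≤ ∑ i ∈ M, m i := by
  classical
  simp only [Set.singleton_add, Set.mem_image, Set.mem_ofPred_eq]
  constructor
  · rintro ⟨_, ⟨a, ha, rfl⟩, h⟩
    refine ⟨le_trans (by simp) (h j), ha.trans (Finset.sum_le_sum fun i _ => ?_)⟩
    exact le_trans (by simp) (h i)
  · rintro ⟨h1, h2⟩
    refine ⟨m, ⟨m - Finsupp.single j 1, h2.trans_eq (Finset.sum_congr rfl fun i hi => ?_), ?_⟩,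
      le_rfl⟩
    · have : i ≠ j := fun h => hj (h ▸ hi)
      simp [this.symm]
    · exact add_tsub_cancel_of_le (by simpa using h1)

theorem exists_le_sum_le_iff (M : Finset σ) (n : ℕ) (m : σ →₀ ℕ) :
    (∃ s ∈ {m : σ →₀ ℕ | n ≤ ∑ i ∈ M, m i}, s ≤ m) ↔ n ≤ ∑ i ∈ M, m i :=
  ⟨fun ⟨_, hs, h⟩ => le_trans hs (Finset.sum_le_sum fun i _ => h i), fun h => ⟨m, h, le_rfl⟩⟩

end MonomialSpan

section Counting

open Finset

variable {σ : Type*} [DecidableEq σ]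

theorem filter_mem_finsuppAntidiag_iff {M N : Finset σ} (h : M ⊆ N) (s : σ →₀ ℕ) (d : ℕ) :
    s.filter (· ∈ N) ∈ finsuppAntidiag M d ↔ ∑ i ∈ N, s i = d ∧ ∑ i ∈ M, s i = d := by
  have hsum : ∑ i ∈ M, s.filter (· ∈ N) i = ∑ i ∈ M, s i :=
    sum_congr rfl fun i hi => Finsupp.filter_apply_pos _ _ (h hi)
  have hsd := sum_sdiff (f := s) h
  rw [mem_finsuppAntidiag, hsum]
  have key : (s.filter (· ∈ N)).support ⊆ M ↔ ∑ i ∈ N \ M, s i = 0 := by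
    rw [sum_eq_zero_iff]
    simp only [subset_iff, Finsupp.support_filter, mem_filter, Finsupp.mem_support_iff, mem_sdiff]
    grind
  rw [key]
  omega

variable [Fintype σ]

theorem mem_image_add_single_iff {N : Finset σ} {a b : σ} (hab : a ≠ b) (ha : a ∉ N)
    (hb : b ∉ N) (huniv : insert a (insert b N) = univ) (Q : Finset ((σ →₀ ℕ) × ℕ × ℕ))
    (hQ : ∀ q ∈ Q, q.1.support ⊆ N) (s : σ →₀ ℕ) :
    s ∈ Q.image (fun q => q.1 + Finsupp.single a q.2.1 + Finsupp.single b q.2.2) ↔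
      (s.filter (· ∈ N), s a, s b) ∈ Q := by
  rw [mem_image]
  constructor
  · rintro ⟨⟨m, x, y⟩, hq, rfl⟩
    have hm : ∀ i, i ∉ N → m i = 0 := fun i hi => by
      by_contra h
      exact hi (hQ _ hq (by simpa using h))
    convert hq using 2
    · ext i
      by_cases hi : i ∈ N
      · have h1 : a ≠ i := by rintro rfl; exact ha hi
        have h2 : b ≠ i := by rintro rfl; exact hb hi
        simp [hi, h1, h2]
      · simp [hi, hm i hi]
    · simp [hm a ha, hm b hb, hab, hab.symm]
  · intro h
    refine ⟨_, h, ?_⟩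
    ext i
    have hi : i ∈ insert a (insert b N) := huniv ▸ mem_univ i
    simp only [mem_insert] at hi
    rcases hi with rfl | rfl | hi
    · simp [ha, hab]
    · simp [hb, hab]
    · have h1 : a ≠ i := by rintro rfl; exact ha hi
      have h2 : b ≠ i := by rintro rfl; exact hb hi
      simp [hi, h1, h2]

theorem card_image_add_single {N : Finset σ} {a b : σ} (hab : a ≠ b) (ha : a ∉ N)
    (hb : b ∉ N) (huniv : insert a (insert b N) = univ) (Q : Finset ((σ →₀ ℕ) × ℕ × ℕ))
    (hQ : ∀ q ∈ Q, q.1.support ⊆ N) :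
    #(Q.image (fun q => q.1 + Finsupp.single a q.2.1 + Finsupp.single b q.2.2)) = #Q := by
  have inj : Function.Injective (fun s : σ →₀ ℕ => (s.filter (· ∈ N), s a, s b)) := by
    intro s u h
    simp only [Prod.mk.injEq] at h
    ext i
    have hi : i ∈ insert a (insert b N) := huniv ▸ mem_univ i
    simp only [mem_insert] at hi
    rcases hi with rfl | rfl | hi
    · exact h.2.1
    · exact h.2.2
    · simpa [hi] using DFunLike.congr_fun h.1 i
  refine le_antisymm card_image_le ?_
  rw [← card_image_of_injective _ inj]
  refine card_le_card fun q hq => mem_image.2 ⟨q.1 + Finsupp.single a q.2.1 +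
    Finsupp.single b q.2.2, mem_image_of_mem _ hq, ?_⟩
  have hm : ∀ i, i ∉ N → q.1 i = 0 := fun i hi => by
    by_contra h
    exact hi (hQ _ hq (by simpa using h))
  refine Prod.ext ?_ (Prod.ext ?_ ?_)
  · ext i
    by_cases hi : i ∈ N
    · have h1 : a ≠ i := by rintro rfl; exact ha hi
      have h2 : b ≠ i := by rintro rfl; exact hb hi
      simp [hi, h1, h2]
    · simp [hi, hm i hi]
  · simp [hm a ha, hab]
  · simp [hm b hb, hab]

/-- The number of monomials of degree `t` outside the ideal
`⟨M₁⟩⁴ + a·⟨M₂⟩³ + b·⟨M₃⟩³`, where `a` and `b` are the two variables not in `M₁`. -/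
theorem card_standard {M₁ M₂ M₃ : Finset σ} {a b : σ} (hab : a ≠ b) (ha : a ∉ M₁)
    (hb : b ∉ M₁) (huniv : insert a (insert b M₁) = univ) (h₂ : M₂ ⊆ M₁) (h₃ : M₃ ⊆ M₂)
    {t : ℕ} (ht : 4 ≤ t) :
    #{s ∈ finsuppAntidiag univ t | ¬(4 ≤ ∑ i ∈ M₁, s i ∨ (1 ≤ s a ∧ 3 ≤ ∑ i ∈ M₂, s i) ∨
      (1 ≤ s b ∧ 3 ≤ ∑ i ∈ M₃, s i))} =
    (#M₁).multichoose 0 * (t + 1) + (#M₁).multichoose 1 * t + (#M₁).multichoose 2 * (t - 1) +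
      ((#M₁).multichoose 3 - (#M₂).multichoose 3) * (t - 2) +
      ((#M₂).multichoose 3 - (#M₃).multichoose 3) := by
  let A (M : Finset σ) (d : ℕ) := finsuppAntidiag M d
  let P₀ := A M₁ 0 ×ˢ antidiagonal t
  let P₁ := A M₁ 1 ×ˢ antidiagonal (t - 1)
  let P₂ := A M₁ 2 ×ˢ antidiagonal (t - 2)
  let P₃ := (A M₁ 3 \ A M₂ 3) ×ˢ antidiagonal (t - 3)
  let P₄ := (A M₂ 3 \ A M₃ 3) ×ˢ {(0, t - 3)}
  have sub : ∀ {M N : Finset σ} (d : ℕ), M ⊆ N → A M d ⊆ A N d :=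
    fun d h => finsuppAntidiag_mono h d
  have dis : ∀ {d e : ℕ}, d ≠ e → Disjoint (A M₁ d) (A M₁ e) := fun h => by
    rw [Finset.disjoint_left]
    intro s h1 h2
    simp only [A, mem_finsuppAntidiag] at h1 h2
    exact h (h1.1.symm.trans h2.1)
  have hc : #(P₀ ∪ P₁ ∪ P₂ ∪ P₃ ∪ P₄) = #P₀ + #P₁ + #P₂ + #P₃ + #P₄ := by
    have hd : ∀ {F G : Finset (σ →₀ ℕ)} (U V : Finset (ℕ × ℕ)), Disjoint F G →
      Disjoint (F ×ˢ U) (G ×ˢ V) := fun U V h => disjoint_product.2 (Or.inl h)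
    have s₃ : A M₁ 3 \ A M₂ 3 ⊆ A M₁ 3 := sdiff_subset
    have s₄ : A M₂ 3 \ A M₃ 3 ⊆ A M₁ 3 := sdiff_subset.trans (sub 3 h₂)
    rw [card_union_of_disjoint, card_union_of_disjoint, card_union_of_disjoint,
      card_union_of_disjoint]
    · exact hd _ _ (dis (by decide))
    · rw [disjoint_union_left]
      exact ⟨hd _ _ (dis (by decide)), hd _ _ (dis (by decide))⟩
    · simp only [disjoint_union_left]
      exact ⟨⟨hd _ _ ((dis (by decide)).mono_right s₃), hd _ _ ((dis (by decide)).mono_right s₃)⟩,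
        hd _ _ ((dis (by decide)).mono_right s₃)⟩
    · simp only [disjoint_union_left]
      exact ⟨⟨⟨hd _ _ ((dis (by decide)).mono_right s₄),
        hd _ _ ((dis (by decide)).mono_right s₄)⟩, hd _ _ ((dis (by decide)).mono_right s₄)⟩,
        hd _ _ (disjoint_of_subset_right sdiff_subset sdiff_disjoint)⟩
  have hsupp : ∀ q ∈ P₀ ∪ P₁ ∪ P₂ ∪ P₃ ∪ P₄, q.1.support ⊆ M₁ := by
    intro q hq
    simp only [P₀, P₁, P₂, P₃, P₄, A, mem_union, mem_product, mem_sdiff,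
      mem_finsuppAntidiag] at hq
    have := @Finset.Subset.trans _ q.1.support M₂ M₁
    tauto
  trans #(P₀ ∪ P₁ ∪ P₂ ∪ P₃ ∪ P₄)
  · rw [← card_image_add_single hab ha hb huniv _ hsupp]
    congr 1
    ext s
    rw [mem_image_add_single_iff hab ha hb huniv _ hsupp]
    have e1 : ∑ i, s i = s a + (s b + ∑ i ∈ M₁, s i) := by
      rw [← huniv, sum_insert (by simp [hab, ha]), sum_insert hb]
    have e2 : ∑ i ∈ M₂, s i ≤ ∑ i ∈ M₁, s i := sum_le_sum_of_subset h₂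
    have e3 : ∑ i ∈ M₃, s i ≤ ∑ i ∈ M₂, s i := sum_le_sum_of_subset h₃
    simp only [P₀, P₁, P₂, P₃, P₄, A, mem_union, mem_product, mem_sdiff, mem_filter,
      filter_mem_finsuppAntidiag_iff (Subset.refl M₁), filter_mem_finsuppAntidiag_iff h₂,
      filter_mem_finsuppAntidiag_iff (h₃.trans h₂), HasAntidiagonal.mem_antidiagonal, mem_singleton,
      Prod.mk.injEq, mem_finsuppAntidiag, subset_univ, and_true, e1]
    generalize ∑ i ∈ M₁, s i = x, ∑ i ∈ M₂, s i = y, ∑ i ∈ M₃, s i = z,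
      s a = u, s b = v at e2 e3 ⊢
    clear * - e2 e3 ht
    rcases (by omega : x = 0 ∨ x = 1 ∨ x = 2 ∨ x = 3 ∨ 4 ≤ x) with rfl | rfl | rfl | rfl | hx
    · simp; omega
    · simp; omega
    · simp; omega
    · simp; omega
    · omega
  · rw [hc]
    simp only [P₀, P₁, P₂, P₃, P₄, A, card_product, Nat.card_antidiagonal, card_singleton,
      card_sdiff_of_subset (finsuppAntidiag_mono h₂ 3),
      card_sdiff_of_subset (finsuppAntidiag_mono h₃ 3),
      card_finsuppAntidiag_nat_eq_multichoose, mul_one]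
    rw [show t - 1 + 1 = t by omega, show t - 2 + 1 = t - 1 by omega,
      show t - 3 + 1 = t - 2 by omega]

end Counting

theorem multichoose_standard (n t : ℕ) (ht : 4 ≤ t) :
    (n + 1).multichoose 0 * (t + 1) + (n + 1).multichoose 1 * t + (n + 1).multichoose 2 * (t - 1) +
      ((n + 1).multichoose 3 - n.multichoose 3) * (t - 2) +
      (n.multichoose 3 - (n - 1).multichoose 3) = (n + 2) ^ 2 * t + 2 - (n + 2) ^ 2 := by
  have h2 : ∀ k : ℕ, 2 * (k + 1).multichoose 2 = (k + 1) * (k + 2) := fun k => by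
    rw [Nat.multichoose_eq, Nat.choose_two_right, Nat.mul_div_cancel']
    · simp [mul_comm]
    · exact (Nat.even_mul_pred_self _).two_dvd
  have h3 : (n + 1).multichoose 3 - n.multichoose 3 = (n + 1).multichoose 2 := by
    rw [Nat.multichoose_succ_succ, Nat.add_sub_cancel_left]
  have h4 : 2 * (n.multichoose 3 - (n - 1).multichoose 3) = n * (n + 1) := by
    cases n with
    | zero => simp
    | succ k =>
      rw [Nat.multichoose_succ_succ, Nat.add_sub_cancel, Nat.add_sub_cancel_left, h2]
  obtain ⟨u, rfl⟩ := Nat.exists_eq_add_of_le' ht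
  have h5 := h2 n
  rw [h3, Nat.multichoose_zero_right, Nat.multichoose_one_right]
  generalize n.multichoose 3 - (n - 1).multichoose 3 = x at *
  generalize (n + 1).multichoose 2 = y at *
  rw [show u + 4 - 1 = u + 3 by omega, show u + 4 - 2 = u + 2 by omega]
  refine Nat.eq_sub_of_add_eq ?_
  nlinarith

theorem varIdeal_eq_span_X (K : Type*) [Field K] {r a b : ℕ} (hb : b ≤ r) :
    varIdeal K r a b = Ideal.span (X ''
      ((Finset.univ.filter fun i : Fin (r + 1) => a ≤ i.val ∧ i.val ≤ b : Finset _) :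
        Set (Fin (r + 1)))) := by
  unfold varIdeal
  congr 1
  ext p
  simp only [Set.mem_ofPred_eq, Set.mem_image, Finset.coe_filter, Finset.mem_univ, true_and]
  constructor
  · rintro ⟨i, h1, h2, rfl⟩
    exact ⟨⟨i, by omega⟩, ⟨h1, h2⟩, by rw [xv, dif_pos (h2.trans hb)]⟩
  · rintro ⟨i, ⟨h1, h2⟩, rfl⟩
    exact ⟨i, h1, h2, by rw [xv, dif_pos (h2.trans hb)]⟩

theorem card_filter_val_mem_Icc {r b : ℕ} (a : ℕ) (hb : b ≤ r) :
    (Finset.univ.filter fun i : Fin (r + 1) => a ≤ i.val ∧ i.val ≤ b).card = b + 1 - a := by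
  rw [← Nat.card_Icc, ← Finset.card_map Fin.valEmbedding]
  congr 1
  ext x
  simp only [Finset.mem_map, Finset.mem_filter, Finset.mem_univ, true_and, Fin.valEmbedding_apply,
    Finset.mem_Icc]
  constructor
  · rintro ⟨i, h, rfl⟩
    exact h
  · intro h
    exact ⟨⟨x, by omega⟩, h, rfl⟩

theorem finrank_restrictScalars_inf_homogeneousSubmodule {σ K : Type*} [Fintype σ] [DecidableEq σ]
    [Field K] (I : Ideal (MvPolynomial σ K)) (P : (σ →₀ ℕ) → Prop) [DecidablePred P]
    (hI : ∀ p, p ∈ I ↔ ∀ m ∈ p.support, P m) (t : ℕ) :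
    Module.finrank K ↥(Submodule.restrictScalars K I ⊓ homogeneousSubmodule σ K t) =
      ((Finset.finsuppAntidiag Finset.univ t).filter P).card := by
  have h : Submodule.restrictScalars K I ⊓ homogeneousSubmodule σ K t =
      restrictSupport K (((Finset.finsuppAntidiag Finset.univ t).filter P : Finset _) :
        Set (σ →₀ ℕ)) := by
    ext p
    rw [Submodule.mem_inf, Submodule.restrictScalars_mem, hI, mem_homogeneousSubmodule,
      mem_restrictSupport_iff]
    have hw (m : σ →₀ ℕ) : Finsupp.weight 1 m = ∑ i, m i := by
      rw [← Finsupp.degree_eq_sum, Finsupp.degree_eq_weight_one]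
      rfl
    simp only [Set.subset_def, Finset.mem_coe, Finset.mem_filter, Finset.mem_finsuppAntidiag,
      Finset.subset_univ, and_true, IsHomogeneous, IsWeightedHomogeneous, mem_support_iff, hw]
    exact ⟨fun h m hm => ⟨h.2 hm, h.1 m hm⟩,
      fun h => ⟨fun m hm => (h m hm).2, fun m hm => (h m hm).1⟩⟩
  rw [h, Module.finrank_eq_card_basis (basisRestrictSupport K _)]
  simp

/-- The dimension of the degree-`t` component of
`J = ⟨x_1,...,x_{r-1}⟩⁴ + x_0·⟨x_2,...,x_{r-1}⟩³ + x_r·⟨x_2,...,x_{r-2}⟩³`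
equals `C(r+t, r) − (r²t + 2 − r²)` for `t ≥ 4`. -/
theorem stmt8 {K : Type*} [Field K] {r t : ℕ} (hr : 2 ≤ r) (ht : 4 ≤ t) :
    Module.finrank K
      ↥(Submodule.restrictScalars K
          ((varIdeal K r 1 (r - 1)) ^ 4
            + Ideal.span {xv 0} * (varIdeal K r 2 (r - 1)) ^ 3
            + Ideal.span {xv r} * (varIdeal K r 2 (r - 2)) ^ 3)
        ⊓ homogeneousSubmodule (Fin (r + 1)) K t)
    = Nat.choose (r + t) r - (r ^ 2 * t + 2 - r ^ 2) := by
  obtain ⟨n, rfl⟩ := Nat.exists_eq_add_of_le' hr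
  let M (a b : ℕ) : Finset (Fin (n + 2 + 1)) := Finset.univ.filter fun i => a ≤ i.val ∧ i.val ≤ b
  have x0 : (xv 0 : MvPolynomial (Fin (n + 2 + 1)) K) = X 0 := by simp [xv]
  have xr : (xv (n + 2) : MvPolynomial (Fin (n + 2 + 1)) K) = X (Fin.last (n + 2)) := by
    simp [xv, Fin.last]
  have ha : ∀ a b, 1 ≤ a → (0 : Fin (n + 2 + 1)) ∉ M a b := fun a b h => by simp [M]; omega
  have hb : ∀ a b, b < n + 2 → Fin.last (n + 2) ∉ M a b := fun a b h => by simp [M]; omega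
  rw [finrank_restrictScalars_inf_homogeneousSubmodule _ (fun s =>
    4 ≤ ∑ i ∈ M 1 (n + 1), s i ∨ (1 ≤ s 0 ∧ 3 ≤ ∑ i ∈ M 2 (n + 1), s i) ∨
      (1 ≤ s (Fin.last (n + 2)) ∧ 3 ≤ ∑ i ∈ M 2 n, s i))]
  · have key := card_standard (M₁ := M 1 (n + 1)) (M₂ := M 2 (n + 1)) (M₃ := M 2 n)
      (a := 0) (b := Fin.last (n + 2)) (by simp [Fin.ext_iff]) (ha _ _ le_rfl)
      (hb _ _ (by omega))
      (by ext i; simp only [M, Finset.mem_insert, Finset.mem_filter, Finset.mem_univ, true_and,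
            Fin.ext_iff, Fin.val_last, Fin.val_zero, iff_true]; omega)
      (fun i => by simp only [M, Finset.mem_filter, Finset.mem_univ, true_and]; omega)
      (fun i => by simp only [M, Finset.mem_filter, Finset.mem_univ, true_and]; omega) ht
    rw [card_filter_val_mem_Icc 1 (by omega), card_filter_val_mem_Icc 2 (by omega),
      card_filter_val_mem_Icc 2 (by omega), show n + 1 + 1 - 1 = n + 1 by omega,
      show n + 1 + 1 - 2 = n by omega, show n + 1 - 2 = n - 1 by omega,
      multichoose_standard n t ht] at key
    rw [← key]
    refine Nat.eq_sub_of_add_eq ?_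
    rw [Finset.card_filter_add_card_filter_not, Finset.card_finsuppAntidiag_nat_eq_multichoose,
      Nat.multichoose_eq, Finset.card_univ, Fintype.card_fin, Nat.add_right_comm,
      Nat.add_sub_cancel, Nat.choose_symm_add]
  · intro p
    rw [varIdeal_eq_span_X K (by omega), varIdeal_eq_span_X K (by omega),
      varIdeal_eq_span_X K (by omega), x0, xr, span_X_pow, span_X_singleton_mul_pow,
      span_X_singleton_mul_pow, Submodule.add_eq_sup, Submodule.add_eq_sup, monomialSpan_sup,
      monomialSpan_sup, mem_monomialSpan]
    refine forall₂_congr fun m _ => ?_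
    simp only [Set.mem_union, or_and_right, exists_or, or_assoc]
    exact or_congr (exists_le_sum_le_iff _ _ _) (or_congr
      (exists_single_add_le_iff (ha _ _ (by omega)) _ _)
      (exists_single_add_le_iff (hb _ _ (by omega)) _ _))
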